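/- Let (Ω, F, P) be a probability space with filtration (F_t)_{t∈ℕ} and let (Y_t)_{t≥1} be an adapted process with Y_t > 0 almost surely, each Y_t integrable, and E[Y_t | F_{t−1}] > 0 almost surely. Suppose: (i) there exists L > 0 such that E[(log Y_t − E[log Y_t | F_{t−1}])²] ≤ L for all t ≥ 1; and (ii) the long-term entropy z_∞(Y) exists, i.e., (1/n) ∑_{t=1}^{n} (log E[Y_t | F_{t−1}] − E[log Y_t | F_{t−1}]) converges P-almost surely to a random variable z_∞(Y). Then V_n(Y) = (∏_{t=1}^{n} Y_t / E[Y_t | F_{t−1}])^{1/n} converges P-almost surely to e^{−z_∞(Y)}. -/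

import Mathlib

open MeasureTheory Filter Finset
open scoped ENNReal NNReal

/-- L2-bounded martingale convergence, phrased for increments. -/
lemma aux_mart {Ω : Type*} {m0 : MeasurableSpace Ω} (μ : Measure Ω) [IsProbabilityMeasure μ]
    (ℱ : Filtration ℕ m0) (D : ℕ → Ω → ℝ) (hD : ∀ i, MemLp (D i) 2 μ)
    (hm : ∀ i, StronglyMeasurable[ℱ (i + 1)] (D i))
    (hc : ∀ i, μ[D i | ℱ i] =ᵐ[μ] 0) (a : ℕ → ℝ) (ha : Summable a)
    (hb : ∀ i, ∫ ω, D i ω ^ 2 ∂μ ≤ a i) :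
    ∀ᵐ ω ∂μ, ∃ c, Tendsto (fun n => ∑ i ∈ range n, D i ω) atTop (nhds c) := by
  have ha0 : ∀ i, 0 ≤ a i := fun i => (integral_nonneg fun ω => sq_nonneg _).trans (hb i)
  let M : ℕ → Ω → ℝ := fun n ω => ∑ i ∈ range n, D i ω
  have hMs : ∀ n, M (n + 1) = M n + D n := by
    intro n; funext ω; simp [M, sum_range_succ]
  have hMm : ∀ n, StronglyMeasurable[ℱ n] (M n) := by
    intro n
    refine Finset.stronglyMeasurable_fun_sum _ fun i hi => ?_
    exact (hm i).mono (ℱ.mono (by have := Finset.mem_range.1 hi; omega))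
  have hM2 : ∀ n, MemLp (M n) 2 μ := fun n => memLp_finsetSum _ fun i _ => hD i
  have hMi : ∀ n, Integrable (M n) μ := fun n => (hM2 n).integrable (by norm_num)
  have hDi : ∀ n, Integrable (D n) μ := fun n => (hD n).integrable (by norm_num)
  have hmart : Martingale M ℱ μ := by
    refine martingale_nat (fun n => hMm n) hMi fun n => ?_
    rw [hMs]
    filter_upwards [condExp_add (hMi n) (hDi n) (ℱ n), hc n] with ω h1 h2
    rw [h1, Pi.add_apply, h2, condExp_of_stronglyMeasurable (ℱ.le n) (hMm n) (hMi n)]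
    simp
  have hsq : ∀ n, ∫ ω, M n ω ^ 2 ∂μ ≤ ∑ i ∈ range n, a i := by
    intro n
    induction n with
    | zero => simp [M]
    | succ n ih =>
      have hMD : Integrable (M n * D n) μ := (hM2 n).integrable_mul (hD n)
      have h0 : ∫ ω, M n ω * D n ω ∂μ = 0 := by
        have h1 := condExp_mul_of_stronglyMeasurable_left (hMm n) hMD (hDi n)
        have h2 : ∫ ω, (M n * D n) ω ∂μ = 0 := by
          rw [← integral_condExp (ℱ.le n)]
          rw [integral_congr_ae h1]
          rw [← integral_zero Ω ℝ (μ := μ)]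
          refine integral_congr_ae ?_
          filter_upwards [hc n] with ω h
          simp [h]
        exact h2
      have he : (fun ω => M (n + 1) ω ^ 2)
          = fun ω => (M n ω ^ 2 + 2 * (M n ω * D n ω)) + D n ω ^ 2 := by
        funext ω; rw [hMs, Pi.add_apply]; ring
      have i1 : Integrable (fun ω => M n ω ^ 2) μ := (hM2 n).integrable_sq
      have i2 : Integrable (fun ω => 2 * (M n ω * D n ω)) μ := hMD.const_mul 2
      have i12 : Integrable (fun ω => M n ω ^ 2 + 2 * (M n ω * D n ω)) μ := i1.add i2
      rw [he, integral_add i12 (hD n).integrable_sq, integral_add i1 i2, integral_const_mul, h0,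
        sum_range_succ]
      linarith [hb n]
  have hbd : ∀ n, eLpNorm (M n) 1 μ ≤ ((1 + ∑' i, a i).toNNReal : ℝ≥0∞) := by
    intro n
    rw [eLpNorm_one_eq_lintegral_enorm, ← ofReal_integral_norm_eq_lintegral_enorm (hMi n)]
    refine ENNReal.ofReal_le_ofReal ?_
    have h1 : ∫ ω, ‖M n ω‖ ∂μ ≤ ∫ ω, (1 + M n ω ^ 2) ∂μ := by
      refine integral_mono (hMi n).norm ((integrable_const 1).add (hM2 n).integrable_sq) fun ω => ?_
      simp only [Real.norm_eq_abs]
      nlinarith [sq_abs (M n ω), sq_nonneg (|M n ω| - 1)]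
    rw [integral_add (integrable_const 1) (hM2 n).integrable_sq] at h1
    have h2 := ha.sum_le_tsum (range n) fun i _ => ha0 i
    simp at h1
    have := hsq n
    simp only [Real.norm_eq_abs]
    linarith
  exact hmart.submartingale.exists_ae_tendsto_of_bdd hbd

/-- Kronecker's lemma for the weights `n`. -/
lemma aux_kron (x : ℕ → ℝ) (c : ℝ)
    (h : Tendsto (fun n => ∑ i ∈ range n, x i / ((i : ℝ) + 1)) atTop (nhds c)) :
    Tendsto (fun n : ℕ => (1 / (n : ℝ)) * ∑ i ∈ range n, x i) atTop (nhds 0) := by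
  set S : ℕ → ℝ := fun n => ∑ i ∈ range n, x i / ((i : ℝ) + 1) with hS
  have key : ∀ n : ℕ, ∑ i ∈ range n, x i = n * S n - ∑ i ∈ range n, S i := by
    intro n
    induction n with
    | zero => simp
    | succ n ih =>
      have : S (n + 1) = S n + x n / ((n : ℝ) + 1) := by simp [hS, sum_range_succ]
      rw [sum_range_succ, sum_range_succ, ih, this]
      have : (n : ℝ) + 1 ≠ 0 := by positivity
      push_cast
      field_simp
      ring
  have h2 := h.sub h.cesaro
  rw [sub_self] at h2
  refine h2.congr' ?_
  filter_upwards [eventually_gt_atTop 0] with n hn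
  have : (n : ℝ) ≠ 0 := by positivity
  rw [key]
  field_simp

/-- Second part of the multiplicative long-run law: if Assumption II holds for
`log Y` and the long-term entropy `z∞(Y)` exists a.s., then the geometric average
`V_n(Y)` converges a.s. to `exp(-z∞(Y))`. -/
theorem geometric_average_tendsto_exp_neg_entropy
    {Ω : Type*} {m0 : MeasurableSpace Ω} (μ : Measure Ω) [IsProbabilityMeasure μ]
    (ℱ : Filtration ℕ m0) (Y : ℕ → Ω → ℝ)
    (hadp : Adapted ℱ Y) (hint : ∀ t, Integrable (Y t) μ)
    (hpos : ∀ t, ∀ᵐ ω ∂μ, 0 < Y t ω)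
    (hcondpos : ∀ t, ∀ᵐ ω ∂μ, 0 < (μ[Y t | ℱ (t - 1)]) ω)
    (L : ℝ) (hL : 0 < L)
    (hvar : ∀ t, 1 ≤ t →
      ∫⁻ ω, (‖Real.log (Y t ω) -
        (μ[fun ω' => Real.log (Y t ω') | ℱ (t - 1)]) ω‖₊ : ℝ≥0∞) ^ 2 ∂μ
        ≤ ENNReal.ofReal L)
    (z : Ω → ℝ)
    (hz : ∀ᵐ ω ∂μ, Tendsto
      (fun n : ℕ => (1 / (n : ℝ)) * ∑ t ∈ Finset.Icc 1 n,
        (Real.log ((μ[Y t | ℱ (t - 1)]) ω) -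
          (μ[fun ω' => Real.log (Y t ω') | ℱ (t - 1)]) ω))
      atTop (nhds (z ω))) :
    ∀ᵐ ω ∂μ, Tendsto
      (fun n : ℕ =>
        (∏ t ∈ Finset.Icc 1 n, (Y t ω / (μ[Y t | ℱ (t - 1)]) ω)) ^ (1 / (n : ℝ)))
      atTop (nhds (Real.exp (-z ω))) := by
  set C : ℕ → Ω → ℝ := fun t => μ[fun ω' => Real.log (Y t ω') | ℱ (t - 1)] with hC
  have hlm : ∀ t, StronglyMeasurable[ℱ t] (fun ω => Real.log (Y t ω)) := fun t =>
    (Real.measurable_log.comp (hadp t)).stronglyMeasurable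
  have hCm : ∀ t, StronglyMeasurable[ℱ (t - 1)] (C t) := fun t => stronglyMeasurable_condExp
  have hXm : ∀ t, StronglyMeasurable[ℱ t] (fun ω => Real.log (Y t ω) - C t ω) := fun t =>
    (hlm t).sub ((hCm t).mono (ℱ.mono (Nat.sub_le t 1)))
  have hX2 : ∀ t, 1 ≤ t → MemLp (fun ω => Real.log (Y t ω) - C t ω) 2 μ := by
    intro t ht
    refine ⟨((hXm t).mono (ℱ.le t)).aestronglyMeasurable, ?_⟩
    rw [eLpNorm_lt_top_iff_lintegral_rpow_enorm_lt_top (by norm_num) (by norm_num)]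
    refine lt_of_le_of_lt ?_ (ENNReal.ofReal_lt_top (r := L))
    simpa [enorm_eq_nnnorm] using hvar t ht
  have hlogi : ∀ t, 1 ≤ t → Integrable (fun ω => Real.log (Y t ω)) μ := by
    intro t ht
    have h1 := ((hX2 t ht).integrable (by norm_num)).add
      (integrable_condExp (μ := μ) (m := ℱ (t - 1)) (f := fun ω' => Real.log (Y t ω')))
    refine h1.congr (ae_of_all _ fun ω => ?_)
    simp [hC]
  have hXsq : ∀ t, 1 ≤ t → ∫ ω, (Real.log (Y t ω) - C t ω) ^ 2 ∂μ ≤ L := by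
    intro t ht
    rw [integral_eq_lintegral_of_nonneg_ae (ae_of_all _ fun ω => sq_nonneg _)
      (hX2 t ht).integrable_sq.aestronglyMeasurable]
    refine ENNReal.toReal_le_of_le_ofReal hL.le (le_trans (le_of_eq ?_) (hvar t ht))
    refine lintegral_congr fun ω => ?_
    rw [← enorm_eq_nnnorm, ← sq_abs, ENNReal.ofReal_pow (abs_nonneg _), ← Real.enorm_eq_ofReal_abs]
  have hconv := aux_mart μ ℱ
    (fun i ω => (Real.log (Y (i + 1) ω) - C (i + 1) ω) / ((i : ℝ) + 1))
    (fun i => by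
      simpa only [div_eq_mul_inv] using (hX2 (i + 1) (by omega)).mul_const (((i : ℝ) + 1)⁻¹))
    (fun i => by
      simpa only [div_eq_mul_inv] using (hXm (i + 1)).mul_const (((i : ℝ) + 1)⁻¹))
    (fun i => by
      have e : (fun ω => (Real.log (Y (i + 1) ω) - C (i + 1) ω) / ((i : ℝ) + 1))
          = (((i : ℝ) + 1)⁻¹) • ((fun ω => Real.log (Y (i + 1) ω)) - C (i + 1)) := by
        funext ω; simp [div_eq_inv_mul]
      have hCi : Integrable (C (i + 1)) μ := integrable_condExp
      rw [e]
      filter_upwards [condExp_smul (μ := μ) (((i : ℝ) + 1)⁻¹)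
        ((fun ω => Real.log (Y (i + 1) ω)) - C (i + 1)) (ℱ i),
        condExp_sub (hlogi (i + 1) (by omega)) hCi (ℱ i)] with ω h1 h2
      have h3 : μ[C (i + 1) | ℱ i] = C (i + 1) :=
        condExp_of_stronglyMeasurable (ℱ.le i) (hCm (i + 1)) hCi
      rw [h1, Pi.smul_apply, h2, Pi.sub_apply, h3]
      simp [hC])
    (fun i => L * (1 / ((i : ℝ) + 1) ^ 2))
    (by
      have := (summable_nat_add_iff 1).2 (Real.summable_one_div_nat_pow.2 one_lt_two)
      refine Summable.mul_left L ?_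
      simpa using this)
    (fun i => by
      simp only [div_pow]
      rw [integral_div, mul_one_div]
      exact div_le_div_of_nonneg_right (hXsq (i + 1) (by omega)) (by positivity))
  filter_upwards [hconv, hz, ae_all_iff.2 hpos, ae_all_iff.2 hcondpos] with ω h1 h2 h3 h4
  obtain ⟨c, hc⟩ := h1
  have hk := aux_kron (fun i => Real.log (Y (i + 1) ω) - C (i + 1) ω) c hc
  have hlim := (Real.continuous_exp.tendsto _).comp (hk.sub h2)
  rw [zero_sub] at hlim
  refine hlim.congr fun n => ?_
  have hr : ∀ t, 0 < Y t ω / (μ[Y t | ℱ (t - 1)]) ω := fun t => div_pos (h3 t) (h4 t)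
  rw [Real.rpow_def_of_pos (prod_pos fun t _ => hr t), Real.log_prod fun t _ => (hr t).ne',
    Function.comp_apply, ← mul_sub, mul_comm]
  congr 2
  have e : ∑ i ∈ range n, (Real.log (Y (i + 1) ω) - C (i + 1) ω)
      = ∑ t ∈ Finset.Icc 1 n, (Real.log (Y t ω) - C t ω) := by
    rw [Finset.range_eq_Ico, Finset.sum_Ico_add' (fun t => Real.log (Y t ω) - C t ω) 0 n 1]
    rfl
  rw [e, ← sum_sub_distrib]
  refine sum_congr rfl fun t _ => ?_
  rw [Real.log_div (h3 t).ne' (h4 t).ne']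
  ring
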